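/- Let ρₙ be norms on ℝ² converging uniformly on the unit circle to a norm ρ, and let Uₙ, U be bounded open convex subsets of ℝ² containing 0 with dist_H(Uₙ, U) → 0. Then 𝒫_ρ(U) ≤ liminfₙ 𝒫_{ρₙ}(Uₙ) (lower semicontinuity of anisotropic perimeter under Hausdorff convergence of convex sets). -/

import Mathlib

open Set Metric MeasureTheory Filter Pointwise Asymptotics

noncomputable section

abbrev E2 := EuclideanSpace ℝ (Fin 2)

/-- `ρ` is a norm on the plane. -/
def IsNorm (ρ : E2 → ℝ) : Prop :=
  (∀ x, ρ x = 0 ↔ x = 0) ∧ (∀ (c : ℝ) (x : E2), ρ (c • x) = |c| * ρ x) ∧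
    ∀ x y, ρ (x + y) ≤ ρ x + ρ y

/-- The `ρ`-length of a curve `γ` on `[0,1]`, as the supremum over inscribed polygons. -/
def polyPerim (ρ : E2 → ℝ) (γ : ℝ → E2) : ℝ :=
  sSup {L | ∃ n : ℕ, ∃ t : Fin (n + 1) → ℝ, StrictMono t ∧ t 0 = 0 ∧ t (Fin.last n) = 1 ∧
    L = ∑ i : Fin n, ρ (γ (t i.succ) - γ (t i.castSucc))}

/-- `γ` is a simple closed curve on `[0,1]` parametrizing the boundary of `U`. -/
def JordanParam (U : Set E2) (γ : ℝ → E2) : Prop :=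
  ContinuousOn γ (Icc 0 1) ∧ γ 0 = γ 1 ∧ InjOn γ (Ico 0 1) ∧ γ '' Icc 0 1 = frontier U

/-- `U` is a Jordan domain. -/
def IsJordanDomain (U : Set E2) : Prop :=
  IsOpen U ∧ Bornology.IsBounded U ∧ ∃ γ : ℝ → E2, JordanParam U γ

/-- The `ρ`-perimeter of a set. -/
def setPerim (ρ : E2 → ℝ) (U : Set E2) : ℝ :=
  sSup {L | ∃ γ : ℝ → E2, JordanParam U γ ∧ L = polyPerim ρ γ}

/-- The principal Dirichlet eigenvalue of the negative Laplacian on `U`. -/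
def eigen (U : Set E2) : ℝ :=
  sInf {L | ∃ g : E2 → ℝ, ContDiff ℝ (⊤ : ℕ∞) g ∧ tsupport g ⊆ U ∧ (∫ x, (g x) ^ 2) = 1 ∧
    L = ∫ x, ‖gradient g x‖ ^ 2}

/-- The functional `ℱ = λ + 𝒫`. -/
def Ffun (ρ : E2 → ℝ) (U : Set E2) : ℝ := eigen U + setPerim ρ U

theorem IsNorm.nonneg {ρ : E2 → ℝ} (h : IsNorm ρ) (x : E2) : 0 ≤ ρ x := by
  have h0 : ρ 0 = 0 := (h.1 0).2 rfl
  have hneg : ρ (-x) = ρ x := by simpa using h.2.1 (-1) x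
  have hadd := h.2.2 x (-x)
  rw [add_neg_cancel, h0, hneg] at hadd
  linarith

theorem E2.norm_le_add_abs (x : E2) : ‖x‖ ≤ |x 0| + |x 1| := by
  rw [EuclideanSpace.norm_eq, Fin.sum_univ_two]
  refine Real.sqrt_le_iff.2 ⟨by positivity, ?_⟩
  simp only [Real.norm_eq_abs]
  nlinarith [mul_nonneg (abs_nonneg (x 0)) (abs_nonneg (x 1))]

theorem IsNorm.exists_le_mul_norm {ρ : E2 → ℝ} (h : IsNorm ρ) :
    ∃ C, 0 ≤ C ∧ ∀ x, ρ x ≤ C * ‖x‖ := by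
  set e₀ : E2 := EuclideanSpace.single 0 1
  set e₁ : E2 := EuclideanSpace.single 1 1
  refine ⟨ρ e₀ + ρ e₁, add_nonneg (h.nonneg _) (h.nonneg _), fun x => ?_⟩
  have hx : x = x 0 • e₀ + x 1 • e₁ := by
    ext i
    fin_cases i <;> simp [e₀, e₁]
  have h0 : |x 0| ≤ ‖x‖ := PiLp.norm_apply_le x 0
  have h1 : |x 1| ≤ ‖x‖ := PiLp.norm_apply_le x 1
  calc ρ x ≤ |x 0| * ρ e₀ + |x 1| * ρ e₁ := by
        conv_lhs => rw [hx]
        exact (h.2.2 _ _).trans_eq (by rw [h.2.1, h.2.1])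
    _ ≤ (ρ e₀ + ρ e₁) * ‖x‖ := by
        nlinarith [mul_le_mul_of_nonneg_right h0 (h.nonneg e₀),
          mul_le_mul_of_nonneg_right h1 (h.nonneg e₁)]

theorem IsNorm.eventually_le_mul_norm {ρn : ℕ → E2 → ℝ} {ρ : E2 → ℝ} (hρn : ∀ n, IsNorm (ρn n))
    (hρ : IsNorm ρ) (hconv : TendstoUniformlyOn ρn ρ atTop (sphere (0 : E2) 1)) :
    ∃ C, 0 ≤ C ∧ ∀ᶠ n in atTop, ∀ x, ρn n x ≤ C * ‖x‖ := by
  obtain ⟨C, hC, hρC⟩ := hρ.exists_le_mul_norm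
  refine ⟨C + 1, by linarith, ?_⟩
  filter_upwards [Metric.tendstoUniformlyOn_iff.1 hconv 1 one_pos] with n hn x
  rcases eq_or_ne x 0 with rfl | hx
  · rw [((hρn n).1 0).2 rfl, norm_zero, mul_zero]
  have hx' : 0 < ‖x‖ := norm_pos_iff.2 hx
  have hmem : ‖x‖⁻¹ • x ∈ sphere (0 : E2) 1 := by
    simp [norm_smul, hx'.ne']
  have h1 := abs_lt.1 (hn _ hmem)
  have h2 := hρC (‖x‖⁻¹ • x)
  rw [mem_sphere_zero_iff_norm.1 hmem] at h2
  have h3 : ρn n (‖x‖⁻¹ • x) ≤ C + 1 := by linarith [h1.1]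
  rw [(hρn n).2.1, abs_of_pos (inv_pos.2 hx'), inv_mul_le_iff₀ hx'] at h3
  linarith

theorem IsNorm.tendsto_apply {ρn : ℕ → E2 → ℝ} {ρ : E2 → ℝ} (hρn : ∀ n, IsNorm (ρn n))
    (hρ : IsNorm ρ) (hconv : TendstoUniformlyOn ρn ρ atTop (sphere (0 : E2) 1))
    {u : ℕ → E2} {x : E2} (hu : Tendsto u atTop (nhds x)) :
    Tendsto (fun n => ρn n (u n)) atTop (nhds (ρ x)) := by
  have hpt : Tendsto (fun n => ρn n x) atTop (nhds (ρ x)) := by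
    rcases eq_or_ne x 0 with rfl | hx
    · simp [((hρn _).1 0).2 rfl, (hρ.1 0).2 rfl]
    have hx' : 0 < ‖x‖ := norm_pos_iff.2 hx
    have hmem : ‖x‖⁻¹ • x ∈ sphere (0 : E2) 1 := by
      simp [norm_smul, hx'.ne']
    have h := (hconv.tendsto_at hmem).const_mul ‖x‖
    simpa [(hρn _).2.1, hρ.2.1, hx'.ne'] using h
  obtain ⟨C, -, hC⟩ := IsNorm.eventually_le_mul_norm hρn hρ hconv
  have hdiff : Tendsto (fun n => ρn n (u n) - ρn n x) atTop (nhds 0) := by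
    have hlim : Tendsto (fun n => C * ‖u n - x‖) atTop (nhds 0) := by
      simpa using (tendsto_iff_norm_sub_tendsto_zero.1 hu).const_mul C
    refine squeeze_zero_norm' ?_ hlim
    filter_upwards [hC] with n hn
    have h1 := (hρn n).2.2 (u n - x) x
    have h2 := (hρn n).2.2 (x - u n) (u n)
    have h3 := hn (u n - x)
    have h4 := hn (x - u n)
    rw [norm_sub_rev] at h4
    rw [sub_add_cancel] at h1 h2
    exact abs_le.2 ⟨by linarith, by linarith⟩
  simpa using hdiff.add hpt

/-- On a line parallel to a coordinate axis, each ray issuing from a point of an open convex set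
meets the frontier at most once. -/
theorem Convex.eq_of_mem_frontier_of_same_side {U : Set E2} (hU : Convex ℝ U) (ho : IsOpen U)
    {k l : Fin 2} (hkl : k ≠ l) {u p q : E2} (hu : u ∈ U) (hp : p ∈ frontier U)
    (hq : q ∈ frontier U) (hpk : p k = u k) (hqk : q k = u k)
    (hpq : 0 < (p l - u l) * (q l - u l)) : p = q := by
  wlog hle : |p l - u l| ≤ |q l - u l| generalizing p q
  · exact (this hq hp hqk hpk (by linarith) (le_of_not_ge hle)).symm
  have hq0 : q l - u l ≠ 0 := by
    intro h
    simp [h] at hpq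
  set s := (p l - u l) / (q l - u l) with hs
  have hs0 : 0 < s := by
    have : s = (p l - u l) * (q l - u l) / (q l - u l) ^ 2 := by
      rw [hs]; field_simp
    rw [this]; positivity
  have hs1 : s ≤ 1 := by
    rw [← abs_of_pos hs0, hs, abs_div]
    exact div_le_one_of_le₀ hle (abs_nonneg _)
  have hpe : p = (1 - s) • u + s • q := by
    ext i
    have hi : i = k ∨ i = l := by omega
    rcases hi with rfl | rfl
    · simp [hpk, hqk]
      ring
    · have : s * (q i - u i) = p i - u i := by rw [hs]; field_simp
      simp
      linarith
  rcases hs1.lt_or_eq with hs1 | hs1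
  · exfalso
    have hpU : p ∈ interior U :=
      hU.openSegment_interior_closure_subset_interior (by rwa [ho.interior_eq])
        (frontier_subset_closure hq) ⟨1 - s, s, by linarith, hs0, by ring, hpe.symm⟩
    exact hp.2 hpU
  · simpa [hs1] using hpe

/-- A line parallel to a coordinate axis that separates two points of the closure of an open convex
set meets the set. -/
theorem Convex.exists_mem_apply_eq {U : Set E2} (hU : Convex ℝ U) (k : Fin 2)
    {a b : E2} (ha : a ∈ closure U) (hb : b ∈ closure U) {c : ℝ}
    (hc : c ∈ Ioo (a k) (b k)) : ∃ u ∈ U, u k = c := by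
  have hk : Continuous fun x : E2 => x k := by fun_prop
  obtain ⟨a', ha', haU⟩ := mem_closure_iff.1 ha _ (isOpen_lt hk continuous_const) hc.1
  obtain ⟨b', hb', hbU⟩ := mem_closure_iff.1 hb _ (isOpen_lt continuous_const hk) hc.2
  exact hU.isPreconnected.intermediate_value haU hbU hk.continuousOn ⟨ha'.le, hb'.le⟩

theorem sum_toReal_volume_le_of_multiplicity_le_two {ι : Type*} (s : Finset ι) (A : ι → Set ℝ)
    (hA : ∀ i, MeasurableSet (A i)) {R : ℝ} (hR : 0 ≤ R) (hAR : ∀ i, A i ⊆ Icc (-R) R)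
    (hmult : ∀ c, ∃ T : Finset ι, T.card ≤ 2 ∧ ∀ i, c ∈ A i → i ∈ T) :
    ∑ i ∈ s, (volume (A i)).toReal ≤ 4 * R := by
  have hle : ∑ i ∈ s, volume (A i) ≤ ENNReal.ofReal (4 * R) := by
    calc ∑ i ∈ s, volume (A i) = ∑ i ∈ s, ∫⁻ c, (A i).indicator 1 c := by
          simp [lintegral_indicator_one (hA _)]
      _ = ∫⁻ c, ∑ i ∈ s, (A i).indicator 1 c :=
          (lintegral_finsetSum s fun i _ => measurable_one.indicator (hA i)).symm
      _ ≤ ∫⁻ c, (Icc (-R) R).indicator (fun _ => 2) c := by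
          refine lintegral_mono fun c => ?_
          classical
          by_cases hc : c ∈ Icc (-R) R
          · obtain ⟨T, hT, hmem⟩ := hmult c
            rw [Set.indicator_of_mem hc]
            calc ∑ i ∈ s, (A i).indicator 1 c ≤ ∑ i ∈ s, if i ∈ T then (1 : ENNReal) else 0 := by
                  refine Finset.sum_le_sum fun i _ => ?_
                  by_cases hi : c ∈ A i
                  · simp [hi, hmem i hi]
                  · simp [hi]
              _ = ((s ∩ T).card : ENNReal) := by simp
              _ ≤ 2 := by
                  have : (s ∩ T).card ≤ 2 :=
                    (Finset.card_le_card Finset.inter_subset_right).trans hT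
                  exact_mod_cast this
          · rw [Set.indicator_of_notMem hc]
            refine (Finset.sum_eq_zero fun i _ => ?_).le
            exact Set.indicator_of_notMem (fun h => hc (hAR i h)) _
      _ = ENNReal.ofReal (4 * R) := by
          rw [lintegral_indicator measurableSet_Icc, setLIntegral_const, Real.volume_Icc,
            ← ENNReal.ofReal_ofNat 2, ← ENNReal.ofReal_mul (by norm_num)]
          ring_nf
  have hfin : ∀ i ∈ s, volume (A i) ≠ ⊤ := fun i _ =>
    ne_top_of_le_ne_top (by simp) (measure_mono (hAR i))
  rw [← ENNReal.toReal_sum hfin]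
  exact ENNReal.toReal_le_of_le_ofReal (by linarith) hle

theorem JordanParam.mem_frontier {U : Set E2} {γ : ℝ → E2} (h : JordanParam U γ) {s : ℝ}
    (hs : s ∈ Icc (0 : ℝ) 1) : γ s ∈ frontier U :=
  h.2.2.2 ▸ mem_image_of_mem γ hs

theorem mem_Icc_of_strictMono {m : ℕ} {t : Fin (m + 1) → ℝ} (ht : StrictMono t) (h0 : t 0 = 0)
    (h1 : t (Fin.last m) = 1) (i : Fin (m + 1)) : t i ∈ Icc (0 : ℝ) 1 :=
  ⟨h0 ▸ ht.monotone (Fin.zero_le i), h1 ▸ ht.monotone (Fin.le_last i)⟩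

/-- Total variation of a coordinate along the boundary of a convex set is bounded: every level is
crossed at most twice. -/
theorem JordanParam.sum_abs_apply_sub_le {U : Set E2} {γ : ℝ → E2} (h : JordanParam U γ)
    (ho : IsOpen U) (hU : Convex ℝ U) {R : ℝ} (hR : 0 ≤ R) (hUR : ∀ x ∈ closure U, ‖x‖ ≤ R)
    (k : Fin 2) {m : ℕ} {t : Fin (m + 1) → ℝ} (ht : StrictMono t) (h0 : t 0 = 0)
    (h1 : t (Fin.last m) = 1) :
    ∑ i : Fin m, |γ (t i.succ) k - γ (t i.castSucc) k| ≤ 4 * R := by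
  have htI := mem_Icc_of_strictMono ht h0 h1
  have hcl : ∀ i, γ (t i) ∈ closure U := fun i => frontier_subset_closure (h.mem_frontier (htI i))
  have hkR : ∀ i, γ (t i) k ∈ Icc (-R) R := fun i =>
    abs_le.1 ((PiLp.norm_apply_le _ k).trans (hUR _ (hcl i)))
  obtain ⟨l, hkl⟩ : ∃ l : Fin 2, k ≠ l := ⟨1 - k, by fin_cases k <;> simp⟩
  let A : Fin m → Set ℝ := fun i =>
    Ioo (min (γ (t i.castSucc) k) (γ (t i.succ) k)) (max (γ (t i.castSucc) k) (γ (t i.succ) k))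
  have hvol : ∀ i, |γ (t i.succ) k - γ (t i.castSucc) k| = (volume (A i)).toReal := fun i => by
    rw [Real.volume_Ioo, ENNReal.toReal_ofReal (by simp), max_sub_min_eq_abs]
  simp_rw [hvol]
  refine sum_toReal_volume_le_of_multiplicity_le_two _ A (fun i => measurableSet_Ioo) hR
    (fun i c hc => ?_) ?_
  · exact ⟨(le_min (hkR _).1 (hkR _).1).trans hc.1.le, hc.2.le.trans (max_le (hkR _).2 (hkR _).2)⟩
  intro c
  classical
  by_cases hne : ∃ i, c ∈ A i
  swap
  · exact ⟨∅, by simp, fun i hi => (hne ⟨i, hi⟩).elim⟩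
  obtain ⟨u, huU, huk⟩ : ∃ u ∈ U, u k = c := by
    obtain ⟨i, hi⟩ := hne
    rcases le_total (γ (t i.castSucc) k) (γ (t i.succ) k) with hle | hle
    · exact hU.exists_mem_apply_eq k (hcl _) (hcl _) (by simpa [A, hle] using hi)
    · exact hU.exists_mem_apply_eq k (hcl _) (hcl _) (by simpa [A, hle] using hi)
  have hcross : ∀ i, c ∈ A i → ∃ s ∈ Ioo (t i.castSucc) (t i.succ), γ s k = c := by
    intro i hi
    have hlt : t i.castSucc < t i.succ := ht Fin.castSucc_lt_succ
    have hcont : ContinuousOn (fun s => γ s k) (Icc (t i.castSucc) (t i.succ)) :=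
      (show Continuous fun x : E2 => x k by fun_prop).comp_continuousOn
        (h.1.mono (Icc_subset_Icc (htI _).1 (htI _).2))
    rcases le_total (γ (t i.castSucc) k) (γ (t i.succ) k) with hle | hle
    · exact intermediate_value_Ioo hlt.le hcont (by simpa [A, hle] using hi)
    · exact intermediate_value_Ioo' hlt.le hcont (by simpa [A, hle] using hi)
  choose! σ hσ hσc using hcross
  have hσI : ∀ i, c ∈ A i → σ i ∈ Ico (0 : ℝ) 1 := fun i hi =>
    ⟨(htI _).1.trans (hσ i hi).1.le, (hσ i hi).2.trans_le (htI _).2⟩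
  have hσF : ∀ i, c ∈ A i → γ (σ i) ∈ frontier U := fun i hi =>
    h.mem_frontier (Ico_subset_Icc_self (hσI i hi))
  have hne_u : ∀ i, c ∈ A i → γ (σ i) l ≠ u l := by
    intro i hi heq
    have : γ (σ i) = u := by
      ext j
      have hj : j = k ∨ j = l := by omega
      rcases hj with rfl | rfl
      · rw [hσc i hi, huk]
      · exact heq
    have hnot := (hσF i hi).2
    rw [this, ho.interior_eq] at hnot
    exact hnot huU
  have hinj : ∀ i j, c ∈ A i → c ∈ A j → (u l < γ (σ i) l ↔ u l < γ (σ j) l) → i = j := by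
    intro i j hi hj hij
    have hprod : 0 < (γ (σ i) l - u l) * (γ (σ j) l - u l) := by
      by_cases hlt : u l < γ (σ i) l
      · exact mul_pos (sub_pos.2 hlt) (sub_pos.2 (hij.1 hlt))
      · exact mul_pos_of_neg_of_neg
          (sub_neg.2 (lt_of_le_of_ne (not_lt.1 hlt) (hne_u i hi)))
          (sub_neg.2 (lt_of_le_of_ne (not_lt.1 fun h' => hlt (hij.2 h')) (hne_u j hj)))
    have heq : γ (σ i) = γ (σ j) :=
      hU.eq_of_mem_frontier_of_same_side ho hkl huU (hσF i hi) (hσF j hj)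
        ((hσc i hi).trans huk.symm) ((hσc j hj).trans huk.symm) hprod
    have hσeq : σ i = σ j := h.2.2.1 (hσI i hi) (hσI j hj) heq
    have hij1 := ht.lt_iff_lt.1 ((hσ i hi).1.trans (hσeq ▸ (hσ j hj).2))
    have hij2 := ht.lt_iff_lt.1 ((hσ j hj).1.trans (hσeq ▸ (hσ i hi).2))
    simp only [Fin.lt_def, Fin.val_castSucc, Fin.val_succ] at hij1 hij2
    omega
  refine ⟨Finset.univ.filter (fun i => c ∈ A i), ?_, fun i hi => by simpa using hi⟩
  refine Finset.card_le_card_of_injOn (t := (Finset.univ : Finset Bool))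
    (fun i => decide (u l < γ (σ i) l)) (fun _ _ => Finset.mem_univ _) ?_
  intro i hi j hj hij
  exact hinj i j (by simpa using hi) (by simpa using hj) (by simpa using hij)

theorem JordanParam.sum_le {U : Set E2} {γ : ℝ → E2} (h : JordanParam U γ)
    (ho : IsOpen U) (hU : Convex ℝ U) {R : ℝ} (hR : 0 ≤ R) (hUR : ∀ x ∈ closure U, ‖x‖ ≤ R)
    {ρ : E2 → ℝ} {C : ℝ} (hC : 0 ≤ C) (hρ : ∀ x, ρ x ≤ C * ‖x‖)
    {m : ℕ} {t : Fin (m + 1) → ℝ} (ht : StrictMono t) (h0 : t 0 = 0) (h1 : t (Fin.last m) = 1) :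
    ∑ i : Fin m, ρ (γ (t i.succ) - γ (t i.castSucc)) ≤ C * (8 * R) := by
  calc ∑ i : Fin m, ρ (γ (t i.succ) - γ (t i.castSucc))
      ≤ ∑ i : Fin m, C * (|γ (t i.succ) 0 - γ (t i.castSucc) 0| +
          |γ (t i.succ) 1 - γ (t i.castSucc) 1|) :=
        Finset.sum_le_sum fun i _ =>
          (hρ _).trans (mul_le_mul_of_nonneg_left (E2.norm_le_add_abs _) hC)
    _ ≤ C * (8 * R) := by
        rw [← Finset.mul_sum, Finset.sum_add_distrib]
        refine mul_le_mul_of_nonneg_left ?_ hC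
        linarith [h.sum_abs_apply_sub_le ho hU hR hUR 0 ht h0 h1,
          h.sum_abs_apply_sub_le ho hU hR hUR 1 ht h0 h1]

theorem JordanParam.polyPerim_le {U : Set E2} {γ : ℝ → E2} (h : JordanParam U γ)
    (ho : IsOpen U) (hU : Convex ℝ U) {R : ℝ} (hR : 0 ≤ R) (hUR : ∀ x ∈ closure U, ‖x‖ ≤ R)
    {ρ : E2 → ℝ} {C : ℝ} (hC : 0 ≤ C) (hρ : ∀ x, ρ x ≤ C * ‖x‖) :
    polyPerim ρ γ ≤ C * (8 * R) := by
  refine Real.sSup_le ?_ (by positivity)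
  rintro _ ⟨m, t, ht, h0, h1, rfl⟩
  exact h.sum_le ho hU hR hUR hC hρ ht h0 h1

theorem setPerim_le {U : Set E2} (ho : IsOpen U) (hU : Convex ℝ U) {R : ℝ} (hR : 0 ≤ R)
    (hUR : ∀ x ∈ closure U, ‖x‖ ≤ R) {ρ : E2 → ℝ} {C : ℝ} (hC : 0 ≤ C)
    (hρ : ∀ x, ρ x ≤ C * ‖x‖) : setPerim ρ U ≤ C * (8 * R) := by
  refine Real.sSup_le ?_ (by positivity)
  rintro _ ⟨γ, h, rfl⟩
  exact h.polyPerim_le ho hU hR hUR hC hρ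

theorem JordanParam.sum_le_setPerim {U : Set E2} {γ : ℝ → E2} (h : JordanParam U γ)
    (ho : IsOpen U) (hU : Convex ℝ U) {R : ℝ} (hR : 0 ≤ R) (hUR : ∀ x ∈ closure U, ‖x‖ ≤ R)
    {ρ : E2 → ℝ} {C : ℝ} (hC : 0 ≤ C) (hρ : ∀ x, ρ x ≤ C * ‖x‖)
    {m : ℕ} {t : Fin (m + 1) → ℝ} (ht : StrictMono t) (h0 : t 0 = 0) (h1 : t (Fin.last m) = 1) :
    ∑ i : Fin m, ρ (γ (t i.succ) - γ (t i.castSucc)) ≤ setPerim ρ U := by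
  have hpoly : ∑ i : Fin m, ρ (γ (t i.succ) - γ (t i.castSucc)) ≤ polyPerim ρ γ := by
    refine le_csSup ⟨C * (8 * R), ?_⟩ ⟨m, t, ht, h0, h1, rfl⟩
    rintro _ ⟨m', t', ht', h0', h1', rfl⟩
    exact h.sum_le ho hU hR hUR hC hρ ht' h0' h1'
  refine hpoly.trans (le_csSup ⟨C * (8 * R), ?_⟩ ⟨γ, h, rfl⟩)
  rintro _ ⟨γ', h', rfl⟩
  exact h'.polyPerim_le ho hU hR hUR hC hρ

theorem setPerim_nonneg {ρ : E2 → ℝ} (hρ : IsNorm ρ) (U : Set E2) : 0 ≤ setPerim ρ U := by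
  refine Real.sSup_nonneg ?_
  rintro _ ⟨γ, -, rfl⟩
  refine Real.sSup_nonneg ?_
  rintro _ ⟨m, t, -, -, -, rfl⟩
  exact Finset.sum_nonneg fun i _ => hρ.nonneg _

/-- Radial rescaling carries a parametrization of one convex boundary to another. -/
theorem JordanParam.gaugeRescale {U V : Set E2} (hV : Convex ℝ V) (hV0 : V ∈ nhds (0 : E2))
    (hVb : Bornology.IsBounded V) (hU : Convex ℝ U) (hU0 : U ∈ nhds (0 : E2))
    (hUb : Bornology.IsBounded U) {γ : ℝ → E2} (h : JordanParam V γ) :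
    JordanParam U (fun s => gaugeRescale V U (γ s)) := by
  have hVn := NormedSpace.isVonNBounded_of_isBounded ℝ hVb
  have hUn := NormedSpace.isVonNBounded_of_isBounded ℝ hUb
  let e := gaugeRescaleHomeomorph V U hV hV0 hVn hU hU0 hUn
  have hfr : e '' frontier V = frontier U := by
    rw [← closure_sdiff_interior, ← closure_sdiff_interior, image_sdiff e.injective,
      image_gaugeRescaleHomeomorph_interior, image_gaugeRescaleHomeomorph_closure]
  refine ⟨e.continuous.comp_continuousOn h.1, congrArg e h.2.1,
    e.injective.comp_injOn h.2.2.1, ?_⟩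
  rw [← hfr, ← h.2.2.2, image_image]
  rfl

/-- A ball contained in the closure of a set that is Hausdorff-close to an open convex set has its
centre in that convex set. -/
theorem Convex.mem_of_closedBall_subset {U W : Set E2} (hU : Convex ℝ U) (ho : IsOpen U)
    {q : E2} {δ : ℝ} (hδ : 0 ≤ δ) (hq : closedBall q δ ⊆ W)
    (hclose : ∀ w ∈ W, ∃ u ∈ closure U, dist w u < δ) : q ∈ U := by
  by_contra hqU
  obtain ⟨f, hf⟩ := geometric_hahn_banach_open_point hU ho hqU
  have hfcl : ∀ u ∈ closure U, f u ≤ f q := fun u hu =>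
    closure_minimal (fun x hx => (hf x hx).le) (isClosed_le f.continuous continuous_const) hu
  set g := (InnerProductSpace.toDual ℝ E2).symm f with hg
  have hfg : ∀ x, f x = inner ℝ g x := fun x => by simp [hg]
  have hg0 : 0 < ‖g‖ := by
    refine norm_pos_iff.2 fun h0 => ?_
    obtain ⟨u, hu, -⟩ := hclose q (hq (mem_closedBall_self hδ))
    obtain ⟨u', hu'⟩ := closure_nonempty_iff.1 ⟨u, hu⟩
    have := hf u' hu'
    simp [hfg, h0] at this
  obtain ⟨u, hu, hdist⟩ := hclose (q + (δ / ‖g‖) • g) (hq (by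
    simp [norm_smul, abs_of_nonneg hδ, hg0.ne']))
  have h1 : inner ℝ g (q + (δ / ‖g‖) • g - u) ≤ ‖g‖ * ‖q + (δ / ‖g‖) • g - u‖ :=
    real_inner_le_norm _ _
  have h2 := hfcl u hu
  rw [hfg, hfg] at h2
  rw [inner_sub_right, inner_add_right, inner_smul_right, real_inner_self_eq_norm_sq] at h1
  have h3 : δ / ‖g‖ * ‖g‖ ^ 2 = ‖g‖ * δ := by field_simp
  rw [dist_eq_norm] at hdist
  nlinarith [mul_lt_mul_of_pos_left hdist hg0]

theorem exists_dist_lt_of_hausdorffDist_closure_lt {X Y : Set E2} (hX : X.Nonempty)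
    (hY : Y.Nonempty) (hXb : Bornology.IsBounded X) (hYb : Bornology.IsBounded Y) {δ : ℝ}
    (h : hausdorffDist (closure X) (closure Y) < δ) :
    ∀ x ∈ closure X, ∃ y ∈ closure Y, dist x y < δ := fun _ hx =>
  exists_dist_lt_of_hausdorffDist_lt hx h
    (hausdorffEDist_ne_top_of_nonempty_of_bounded hX.closure hY.closure hXb.closure hYb.closure)

theorem tendsto_gaugeRescale {U : ℕ → Set E2} {V : Set E2}
    (hUo : ∀ n, IsOpen (U n)) (hUb : ∀ n, Bornology.IsBounded (U n))
    (hUc : ∀ n, Convex ℝ (U n)) (h0U : ∀ n, (0 : E2) ∈ U n)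
    (hVo : IsOpen V) (hVb : Bornology.IsBounded V) (hVc : Convex ℝ V) (h0V : (0 : E2) ∈ V)
    (hH : Tendsto (fun n => hausdorffDist (closure (U n)) (closure V)) atTop (nhds 0))
    {p : E2} (hp : p ∈ frontier V) :
    Tendsto (fun n => gaugeRescale V (U n) p) atTop (nhds p) := by
  have hV0 : V ∈ nhds (0 : E2) := hVo.mem_nhds h0V
  have hgV : gauge V p = 1 := (gauge_eq_one_iff_mem_frontier hVc hV0).2 hp
  have hp0 : p ≠ 0 := by
    rintro rfl
    simp at hgV
  have hgU : ∀ n, 0 < gauge (U n) p := fun n =>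
    (gauge_pos (absorbent_nhds_zero ((hUo n).mem_nhds (h0U n)))
      (NormedSpace.isVonNBounded_of_isBounded ℝ (hUb n))).2 hp0
  have hmemU : ∀ n {r : ℝ}, 0 ≤ r → (r • p ∈ U n ↔ r < (gauge (U n) p)⁻¹) := by
    intro n r hr
    rw [← (hUo n).interior_eq, ← gauge_lt_one_iff_mem_interior (hUc n)
      ((hUo n).mem_nhds (h0U n)), gauge_smul_of_nonneg hr, (hUo n).interior_eq, smul_eq_mul,
      ← one_div, lt_div_iff₀ (hgU n)]
  have hinv : Tendsto (fun n => (gauge (U n) p)⁻¹) atTop (nhds 1) := by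
    refine tendsto_order.2 ⟨fun a ha => ?_, fun a ha => ?_⟩
    · set r := max a 0
      have hr1 : r < 1 := max_lt ha one_pos
      have hr0 : 0 ≤ r := le_max_right _ _
      have hrV : r • p ∈ V := by
        rw [← hVo.interior_eq, ← gauge_lt_one_iff_mem_interior hVc hV0,
          gauge_smul_of_nonneg hr0, hgV]
        simpa using hr1
      obtain ⟨δ, hδ, hball⟩ := Metric.nhds_basis_closedBall.mem_iff.1 (hVo.mem_nhds hrV)
      filter_upwards [hH.eventually_lt_const hδ] with n hn
      rw [hausdorffDist_comm] at hn
      have hmem := (hUc n).mem_of_closedBall_subset (hUo n) hδ.le (hball.trans subset_closure)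
        (exists_dist_lt_of_hausdorffDist_closure_lt ⟨0, h0V⟩ ⟨0, h0U n⟩ hVb (hUb n) hn)
      exact (le_max_left a 0).trans_lt ((hmemU n hr0).1 hmem)
    · obtain ⟨r, hr1, hra⟩ := exists_between ha
      have hr0 : 0 ≤ r := by linarith
      have hrV : r • p ∉ closure V := by
        rw [← gauge_le_one_iff_mem_closure hVc hV0, gauge_smul_of_nonneg hr0, hgV]
        simpa using hr1
      obtain ⟨δ, hδ, hball⟩ := Metric.nhds_basis_ball.mem_iff.1
        (isClosed_closure.isOpen_compl.mem_nhds hrV)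
      filter_upwards [hH.eventually_lt_const hδ] with n hn
      refine lt_of_le_of_lt (not_lt.1 fun hlt => ?_) hra
      obtain ⟨y, hy, hdist⟩ := exists_dist_lt_of_hausdorffDist_closure_lt ⟨0, h0U n⟩ ⟨0, h0V⟩
        (hUb n) hVb hn _ (subset_closure ((hmemU n hr0).2 hlt))
      exact hball (mem_ball'.2 hdist) hy
  simpa [gaugeRescale_def, hgV] using hinv.smul_const p

/-- Lower semicontinuity of the anisotropic perimeter under Hausdorff convergence
of convex sets and uniform convergence of the norms. -/
theorem stmt13 (ρn : ℕ → E2 → ℝ) (ρ : E2 → ℝ) (hρn : ∀ n, IsNorm (ρn n)) (hρ : IsNorm ρ)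
    (hconv : TendstoUniformlyOn ρn ρ atTop (sphere (0 : E2) 1))
    (U : ℕ → Set E2) (V : Set E2)
    (hUo : ∀ n, IsOpen (U n)) (hUb : ∀ n, Bornology.IsBounded (U n))
    (hUc : ∀ n, Convex ℝ (U n)) (h0U : ∀ n, (0 : E2) ∈ U n)
    (hVo : IsOpen V) (hVb : Bornology.IsBounded V) (hVc : Convex ℝ V) (h0V : (0 : E2) ∈ V)
    (hH : Tendsto (fun n => hausdorffDist (closure (U n)) (closure V)) atTop (nhds 0)) :
    setPerim ρ V ≤ Filter.atTop.liminf (fun n => setPerim (ρn n) (U n)) := by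
  obtain ⟨C, hC, hρC⟩ := IsNorm.eventually_le_mul_norm hρn hρ hconv
  obtain ⟨R, hR, hVR⟩ := hVb.closure.exists_pos_norm_le
  have hR0 : 0 ≤ R + 1 := by linarith
  have hUR : ∀ᶠ n in atTop, ∀ x ∈ closure (U n), ‖x‖ ≤ R + 1 := by
    filter_upwards [hH.eventually_lt_const one_pos] with n hn x hx
    obtain ⟨y, hy, hdist⟩ := exists_dist_lt_of_hausdorffDist_closure_lt ⟨0, h0U n⟩ ⟨0, h0V⟩
      (hUb n) hVb hn x hx
    have := norm_le_norm_add_norm_sub' x y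
    rw [dist_eq_norm] at hdist
    linarith [hVR y hy]
  have hcob : IsCoboundedUnder (· ≥ ·) atTop (fun n => setPerim (ρn n) (U n)) := by
    refine IsBoundedUnder.isCoboundedUnder_ge ⟨C * (8 * (R + 1)), ?_⟩
    rw [eventually_map]
    filter_upwards [hρC, hUR] with n hn hnR
    exact setPerim_le (hUo n) (hUc n) hR0 hnR hC hn
  have hnonneg : 0 ≤ atTop.liminf (fun n => setPerim (ρn n) (U n)) :=
    le_liminf_of_le hcob (Eventually.of_forall fun n => setPerim_nonneg (hρn n) (U n))
  refine Real.sSup_le ?_ hnonneg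
  rintro _ ⟨γ, hγ, rfl⟩
  refine Real.sSup_le ?_ hnonneg
  rintro _ ⟨m, t, ht, h0, h1, rfl⟩
  have hlim : Tendsto (fun n => ∑ i : Fin m, ρn n
      (gaugeRescale V (U n) (γ (t i.succ)) - gaugeRescale V (U n) (γ (t i.castSucc)))) atTop
      (nhds (∑ i : Fin m, ρ (γ (t i.succ) - γ (t i.castSucc)))) := by
    have hpt : ∀ i, Tendsto (fun n => gaugeRescale V (U n) (γ (t i))) atTop (nhds (γ (t i))) :=
      fun i => tendsto_gaugeRescale hUo hUb hUc h0U hVo hVb hVc h0V hH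
        (hγ.mem_frontier (mem_Icc_of_strictMono ht h0 h1 i))
    exact tendsto_finsetSum _ fun i _ =>
      IsNorm.tendsto_apply hρn hρ hconv ((hpt i.succ).sub (hpt i.castSucc))
  refine le_of_forall_lt fun a ha => ?_
  obtain ⟨b, hab, hb⟩ := exists_between ha
  refine hab.trans_le (le_liminf_of_le hcob ?_)
  filter_upwards [hlim.eventually_const_lt hb, hρC, hUR] with n hn hnC hnR
  exact hn.le.trans ((hγ.gaugeRescale hVc (hVo.mem_nhds h0V) hVb (hUc n)
    ((hUo n).mem_nhds (h0U n)) (hUb n)).sum_le_setPerim (hUo n) (hUc n) hR0 hnR hC hnC ht h0 h1)
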